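/- arXiv:1304.6420 — 3 statements merged into one kernel-verified Lean document; each statement's English description precedes it below -/
import Mathlib

section
/- Let G be a graph on vertex set {v^1,…,v^n}, let ℓ ≥ 4 be an integer, and let G' be the graph CliqueGadget(G,ℓ). Then G has a clique of size ℓ if and only if there exist sets B ⊆ H ⊆ V(G') with |B| ≤ ℓ(ℓ−1)/2 and |H| ≥ 3·ℓ(ℓ−1)/2 such that (B,H) is an anchored 3-core of G'. -/
/-- `(B, H)` is an anchored `k`-core of `G`: `B ⊆ H` and every vertex of `H \ B`
has at least `k` neighbors within `H` (i.e. degree at least `k` in `G[H]`). -/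
def IsAnchoredKCore {V : Type*} (G : SimpleGraph V) (k : ℕ) (B H : Set V) : Prop :=
  B ⊆ H ∧ ∀ v ∈ H \ B, k ≤ {u | u ∈ H ∧ G.Adj v u}.ncard

/-- Vertices of `CliqueGadget G ℓ` for a graph `G` on `Fin n`:
`Sum.inl ⟨(r, i, j), _⟩` is the vertex `v^r_{ij}` (for `i ≠ j`), and
`Sum.inr ⟨((r, s), i, j), _⟩` is the green vertex `g^{(r,s)}_{{i,j}}`, indexed by the
ordered pair `(r, s)` with `v^r v^s ∈ E(G)` and the unordered pair `{i,j}` encoded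
by the representative with `i < j`. -/
abbrev GadgetVert (n ℓ : ℕ) (G : SimpleGraph (Fin n)) : Type :=
  {p : Fin n × Fin ℓ × Fin ℓ // p.2.1 ≠ p.2.2} ⊕
  {q : (Fin n × Fin n) × Fin ℓ × Fin ℓ // G.Adj q.1.1 q.1.2 ∧ q.2.1 < q.2.2}

/-- The successor of `j` in the cyclic order `1, 2, …, ℓ, 1, …` on `Fin ℓ`, skipping `i`. -/
def cycNext {ℓ : ℕ} (i j : Fin ℓ) : Fin ℓ :=
  if (⟨(j.val + 1) % ℓ, Nat.mod_lt _ j.pos⟩ : Fin ℓ) = i then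
    ⟨(j.val + 2) % ℓ, Nat.mod_lt _ j.pos⟩
  else
    ⟨(j.val + 1) % ℓ, Nat.mod_lt _ j.pos⟩

/-- `j` and `j'` are consecutive on the cycle `v^r_{i1} – v^r_{i2} – … – v^r_{iℓ} – v^r_{i1}`
through all indices distinct from `i`. -/
def CycleAdj {ℓ : ℕ} (i j j' : Fin ℓ) : Prop :=
  j ≠ i ∧ j' ≠ i ∧ j ≠ j' ∧ (cycNext i j = j' ∨ cycNext i j' = j)

/-- The graph `CliqueGadget(G, ℓ)`: for each `i` and `r` the vertices `v^r_{ij}` (`j ≠ i`)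
form a cycle in the natural cyclic order, and each green vertex `g^{(r,s)}_{{i,j}}`
(with `i < j`) is adjacent exactly to `v^r_{ij}` and `v^s_{ji}`. -/
def CliqueGadget (n ℓ : ℕ) (G : SimpleGraph (Fin n)) : SimpleGraph (GadgetVert n ℓ G) :=
  SimpleGraph.fromRel (fun x y =>
    match x, y with
    | Sum.inl a, Sum.inl b =>
        a.1.1 = b.1.1 ∧ a.1.2.1 = b.1.2.1 ∧ CycleAdj a.1.2.1 a.1.2.2 b.1.2.2
    | Sum.inl a, Sum.inr g =>
        a.1 = (g.1.1.1, g.1.2.1, g.1.2.2) ∨ a.1 = (g.1.1.2, g.1.2.2, g.1.2.1)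
    | _, _ => False)

theorem ncard_pair_le_two {α : Type*} (a b : α) : ({a, b} : Set α).ncard ≤ 2 :=
  (Set.ncard_insert_le a {b}).trans (by rw [Set.ncard_singleton])

theorem card_ne_pairs (ℓ : ℕ) : Nat.card {p : Fin ℓ × Fin ℓ // p.1 ≠ p.2} = ℓ * (ℓ - 1) := by
  have h := Finset.offDiag_card (Finset.univ : Finset (Fin ℓ))
  rw [Finset.card_univ, Fintype.card_fin] at h
  rw [Nat.card_eq_fintype_card, Fintype.card_subtype, Nat.mul_sub_one, ← h]
  congr 1
  ext p
  simp

theorem card_lt_pairs (ℓ : ℕ) : Nat.card {p : Fin ℓ × Fin ℓ // p.1 < p.2} = ℓ * (ℓ - 1) / 2 := by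
  let e : {p : Fin ℓ × Fin ℓ // p.1 < p.2} ≃ Σ j : Fin ℓ, Finset.Iio j :=
    { toFun := fun p => ⟨p.1.2, p.1.1, Finset.mem_Iio.2 p.2⟩
      invFun := fun x => ⟨(x.2.1, x.1), Finset.mem_Iio.1 x.2.2⟩
      left_inv := fun _ => rfl
      right_inv := fun _ => rfl }
  rw [Nat.card_congr e, Nat.card_eq_fintype_card, Fintype.card_sigma]
  simp only [Fintype.card_coe, Fin.card_Iio]
  rw [Fin.sum_univ_eq_sum_range (fun i => i) ℓ, Finset.sum_range_id]

theorem cycNext_val {ℓ : ℕ} (hℓ : 2 ≤ ℓ) (i j : Fin ℓ) :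
    (cycNext i j : ℕ) =
      if (if (j : ℕ) + 1 < ℓ then (j : ℕ) + 1 else 0) = i then
        (if (j : ℕ) + 2 < ℓ then (j : ℕ) + 2 else j + 2 - ℓ)
      else (if (j : ℕ) + 1 < ℓ then (j : ℕ) + 1 else 0) := by
  have hj := j.isLt
  have h1 : ((j : ℕ) + 1) % ℓ = if (j : ℕ) + 1 < ℓ then (j : ℕ) + 1 else 0 := by
    split_ifs with h
    · exact Nat.mod_eq_of_lt h
    · rw [show (j : ℕ) + 1 = ℓ by omega, Nat.mod_self]
  have h2 : ((j : ℕ) + 2) % ℓ = if (j : ℕ) + 2 < ℓ then (j : ℕ) + 2 else j + 2 - ℓ := by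
    split_ifs with h
    · exact Nat.mod_eq_of_lt h
    · rw [Nat.mod_eq_sub_mod (by omega), Nat.mod_eq_of_lt (by omega)]
  simp only [cycNext, Fin.ext_iff, h1, h2]
  split_ifs <;> simp_all

theorem cycNext_ne {ℓ : ℕ} (hℓ : 2 ≤ ℓ) {i j : Fin ℓ} : cycNext i j ≠ i := by
  have h := cycNext_val hℓ i j
  intro h'
  rw [h'] at h
  have := i.isLt
  have := j.isLt
  split_ifs at h <;> omega

theorem CycleAdj.symm {ℓ : ℕ} {i j k : Fin ℓ} (h : CycleAdj i j k) : CycleAdj i k j :=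
  ⟨h.2.1, h.1, h.2.2.1.symm, h.2.2.2.symm⟩

/-- On a cycle of length at least three, the neighbors of `j` are its successor and a
predecessor distinct from it. -/
theorem exists_cycleAdj_iff {ℓ : ℕ} (hℓ : 4 ≤ ℓ) {i j : Fin ℓ} (hij : i ≠ j) :
    ∃ p, p ≠ cycNext i j ∧ ∀ k, CycleAdj i j k ↔ k = cycNext i j ∨ k = p := by
  have hi := i.isLt
  have hj := j.isLt
  have hne : (i : ℕ) ≠ j := fun h => hij (Fin.ext h)
  obtain ⟨m, hp⟩ : ∃ m, m =
      if (if 1 ≤ (j : ℕ) then (j : ℕ) - 1 else ℓ - 1) = i then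
        (if 2 ≤ (j : ℕ) then (j : ℕ) - 2 else j + ℓ - 2)
      else (if 1 ≤ (j : ℕ) then (j : ℕ) - 1 else ℓ - 1) := ⟨_, rfl⟩
  have hm : m < ℓ := by
    rw [hp]
    split_ifs <;> omega
  have hn := cycNext_val (by omega) i j
  refine ⟨⟨m, hm⟩, ?_, fun k => ?_⟩
  · rw [Ne, Fin.ext_iff, hn]
    simp only [hp]
    split_ifs <;> omega
  · have hk := cycNext_val (by omega) i k
    have hkl := k.isLt
    simp only [CycleAdj, ne_eq, Fin.ext_iff]
    rw [hk, hn, hp]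
    split_ifs <;> omega

/-- A set containing one vertex of the cycle and closed under successors contains the cycle. -/
theorem mem_of_cycNext_closed {ℓ : ℕ} (hℓ : 2 ≤ ℓ) {i j : Fin ℓ} {S : Set (Fin ℓ)}
    (hj : j ≠ i) (hjS : j ∈ S) (hS : ∀ k, k ≠ i → k ∈ S → cycNext i k ∈ S)
    {k : Fin ℓ} (hk : k ≠ i) : k ∈ S := by
  have key : ∀ m : ℕ, ∀ k : Fin ℓ, k ≠ i → (k : ℕ) = (j + m) % ℓ → k ∈ S := by
    intro m
    induction m using Nat.strong_induction_on with
    | _ m ih =>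
      intro k hk hkm
      rcases m with _ | m
      · rw [Nat.add_zero, Nat.mod_eq_of_lt j.isLt] at hkm
        rwa [Fin.ext hkm]
      let p : Fin ℓ := ⟨(j + m) % ℓ, Nat.mod_lt _ j.pos⟩
      by_cases hp : p = i
      · rcases m with _ | m
        · exact absurd (Fin.ext (by simp [← hp, p, Nat.mod_eq_of_lt j.isLt])) hj
        let q : Fin ℓ := ⟨(j + m) % ℓ, Nat.mod_lt _ j.pos⟩
        have hqp : (⟨(q.val + 1) % ℓ, Nat.mod_lt _ q.pos⟩ : Fin ℓ) = i := by
          rw [← hp]; ext; simp [p, q, add_assoc]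
        have hqk : cycNext i q = k := by
          rw [cycNext, if_pos hqp]; ext; simp [hkm, q, add_assoc]
        have hqi : q ≠ i := by
          intro h
          have h1 := congrArg Fin.val hqp
          rw [h] at h1
          simp only at h1
          rcases Nat.lt_or_ge (i + 1) ℓ with h2 | h2
          · rw [Nat.mod_eq_of_lt h2] at h1; omega
          · rw [show (i : ℕ) + 1 = ℓ by omega, Nat.mod_self] at h1; omega
        rw [← hqk]
        exact hS q hqi (ih m (by omega) q hqi rfl)
      · have hpk : (⟨(p.val + 1) % ℓ, Nat.mod_lt _ p.pos⟩ : Fin ℓ) = k := by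
          ext; simp [hkm, p, add_assoc]
        have hpk' : cycNext i p = k := by
          rw [cycNext, if_neg (by rw [hpk]; exact hk), hpk]
        rw [← hpk']
        exact hS p hp (ih m (by omega) p hp rfl)
  refine key (k + (ℓ - j)) k hk ?_
  rw [show (j : ℕ) + (k + (ℓ - j)) = k + ℓ by omega, Nat.add_mod_right, Nat.mod_eq_of_lt k.isLt]

section Gadget

variable {n ℓ : ℕ} {G : SimpleGraph (Fin n)}

/-- The two neighbors of a green vertex. -/
def greenEnd (g : {q : (Fin n × Fin n) × Fin ℓ × Fin ℓ // G.Adj q.1.1 q.1.2 ∧ q.2.1 < q.2.2}) :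
    Bool → {p : Fin n × Fin ℓ × Fin ℓ // p.2.1 ≠ p.2.2}
  | true => ⟨(g.1.1.1, g.1.2.1, g.1.2.2), g.2.2.ne⟩
  | false => ⟨(g.1.1.2, g.1.2.2, g.1.2.1), g.2.2.ne'⟩

theorem cliqueGadget_adj_inl_inl {a b : {p : Fin n × Fin ℓ × Fin ℓ // p.2.1 ≠ p.2.2}} :
    (CliqueGadget n ℓ G).Adj (Sum.inl a) (Sum.inl b) ↔
      a.1.1 = b.1.1 ∧ a.1.2.1 = b.1.2.1 ∧ CycleAdj a.1.2.1 a.1.2.2 b.1.2.2 := by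
  simp only [CliqueGadget, SimpleGraph.fromRel_adj]
  constructor
  · rintro ⟨-, h | ⟨h1, h2, h3⟩⟩
    · exact h
    · exact ⟨h1.symm, h2.symm, h2 ▸ h3.symm⟩
  · intro h
    refine ⟨fun hab => h.2.2.2.2.1 ?_, Or.inl h⟩
    rw [Sum.inl.inj hab]

theorem cliqueGadget_adj_inl_inr {a : {p : Fin n × Fin ℓ × Fin ℓ // p.2.1 ≠ p.2.2}}
    {g : {q : (Fin n × Fin n) × Fin ℓ × Fin ℓ // G.Adj q.1.1 q.1.2 ∧ q.2.1 < q.2.2}} :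
    (CliqueGadget n ℓ G).Adj (Sum.inl a) (Sum.inr g) ↔ ∃ b, a = greenEnd g b := by
  simp [CliqueGadget, SimpleGraph.fromRel_adj, greenEnd, Subtype.ext_iff, or_comm]

theorem cliqueGadget_not_adj_inr_inr
    {g h : {q : (Fin n × Fin n) × Fin ℓ × Fin ℓ // G.Adj q.1.1 q.1.2 ∧ q.2.1 < q.2.2}} :
    ¬ (CliqueGadget n ℓ G).Adj (Sum.inr g) (Sum.inr h) := by
  simp [CliqueGadget, SimpleGraph.fromRel_adj]

/-- The successor of `v^r_{ij}` on its cycle. -/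
def gadgetNext (hℓ : 2 ≤ ℓ) (a : {p : Fin n × Fin ℓ × Fin ℓ // p.2.1 ≠ p.2.2}) :
    {p : Fin n × Fin ℓ × Fin ℓ // p.2.1 ≠ p.2.2} :=
  ⟨(a.1.1, a.1.2.1, cycNext a.1.2.1 a.1.2.2), (cycNext_ne hℓ).symm⟩

theorem exists_cliqueGadget_adj_inl_iff (hℓ : 4 ≤ ℓ)
    (a : {p : Fin n × Fin ℓ × Fin ℓ // p.2.1 ≠ p.2.2}) :
    ∃ p, p ≠ gadgetNext (by omega) a ∧ p.1.1 = a.1.1 ∧ p.1.2.1 = a.1.2.1 ∧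
      ∀ b, (CliqueGadget n ℓ G).Adj (Sum.inl a) (Sum.inl b) ↔
        b = gadgetNext (by omega) a ∨ b = p := by
  obtain ⟨⟨r, i, j⟩, hij⟩ := a
  obtain ⟨p, hp, h⟩ := exists_cycleAdj_iff hℓ hij
  have hpi : i ≠ p := ((h p).2 (Or.inr rfl)).2.1.symm
  refine ⟨⟨(r, i, p), hpi⟩, by simpa [gadgetNext] using hp, rfl, rfl, ?_⟩
  rintro ⟨⟨r', i', j'⟩, hij'⟩
  rw [cliqueGadget_adj_inl_inl]
  simp only [h, gadgetNext, Subtype.mk.injEq, Prod.mk.injEq]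
  tauto

theorem inr_mem_of_isAnchoredKCore {B H : Set (GadgetVert n ℓ G)}
    (h : IsAnchoredKCore (CliqueGadget n ℓ G) 3 B H)
    {g : {q : (Fin n × Fin n) × Fin ℓ × Fin ℓ // G.Adj q.1.1 q.1.2 ∧ q.2.1 < q.2.2}}
    (hg : Sum.inr g ∈ H) : (Sum.inr g : GadgetVert n ℓ G) ∈ B := by
  by_contra hgB
  have h3 := h.2 _ ⟨hg, hgB⟩
  have hsub : {u | u ∈ H ∧ (CliqueGadget n ℓ G).Adj (Sum.inr g) u} ⊆
      {Sum.inl (greenEnd g true), Sum.inl (greenEnd g false)} := by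
    rintro (a | g') ⟨-, hu⟩
    · obtain ⟨b | b, rfl⟩ := cliqueGadget_adj_inl_inr.1 hu.symm <;> simp
    · exact absurd hu cliqueGadget_not_adj_inr_inr
  have := Set.ncard_le_ncard hsub (Set.toFinite _)
  have := ncard_pair_le_two (Sum.inl (greenEnd g true) : GadgetVert n ℓ G)
    (Sum.inl (greenEnd g false))
  omega

theorem exists_green_of_isAnchoredKCore (hℓ : 4 ≤ ℓ) {B H : Set (GadgetVert n ℓ G)}
    (h : IsAnchoredKCore (CliqueGadget n ℓ G) 3 B H)
    {a : {p : Fin n × Fin ℓ × Fin ℓ // p.2.1 ≠ p.2.2}} (ha : Sum.inl a ∈ H \ B) :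
    ∃ g b, (Sum.inr g : GadgetVert n ℓ G) ∈ H ∧ greenEnd g b = a := by
  by_contra! hno
  have h3 := h.2 _ ha
  obtain ⟨p, -, -, -, hp⟩ := exists_cliqueGadget_adj_inl_iff (G := G) hℓ a
  have hsub : {u | u ∈ H ∧ (CliqueGadget n ℓ G).Adj (Sum.inl a) u} ⊆
      {Sum.inl (gadgetNext (by omega) a), Sum.inl p} := by
    rintro (b | g) ⟨huH, hu⟩
    · simpa using (hp b).1 hu
    · obtain ⟨b, hb⟩ := cliqueGadget_adj_inl_inr.1 hu
      exact absurd hb.symm (hno g b huH)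
  have := Set.ncard_le_ncard hsub (Set.toFinite _)
  have := ncard_pair_le_two (Sum.inl (gadgetNext (by omega) a) : GadgetVert n ℓ G) (Sum.inl p)
  omega

theorem gadgetNext_mem_of_isAnchoredKCore (hℓ : 4 ≤ ℓ) {B H : Set (GadgetVert n ℓ G)}
    (h : IsAnchoredKCore (CliqueGadget n ℓ G) 3 B H)
    {a : {p : Fin n × Fin ℓ × Fin ℓ // p.2.1 ≠ p.2.2}} (ha : Sum.inl a ∈ H \ B)
    (huniq : ∀ g g' b b', (Sum.inr g : GadgetVert n ℓ G) ∈ H → Sum.inr g' ∈ H →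
      greenEnd g b = a → greenEnd g' b' = a → g = g') :
    Sum.inl (gadgetNext (by omega) a) ∈ H := by
  by_contra hnext
  have h3 := h.2 _ ha
  obtain ⟨p, -, -, -, hp⟩ := exists_cliqueGadget_adj_inl_iff (G := G) hℓ a
  obtain ⟨g, b, hgH, hg⟩ := exists_green_of_isAnchoredKCore hℓ h ha
  have hsub : {u | u ∈ H ∧ (CliqueGadget n ℓ G).Adj (Sum.inl a) u} ⊆
      {Sum.inl p, Sum.inr g} := by
    rintro (c | g') ⟨huH, hu⟩
    · rcases (hp c).1 hu with rfl | rfl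
      · exact absurd huH hnext
      · simp
    · obtain ⟨b', hb'⟩ := cliqueGadget_adj_inl_inr.1 hu
      simp [huniq g' g b' b huH hgH hb'.symm hg]
  have := Set.ncard_le_ncard hsub (Set.toFinite _)
  have := ncard_pair_le_two (Sum.inl p : GadgetVert n ℓ G) (Sum.inr g)
  omega

theorem exists_isNClique_of_isAnchoredKCore (hℓ : 4 ≤ ℓ) {B H : Set (GadgetVert n ℓ G)}
    (hB : B.ncard ≤ ℓ * (ℓ - 1) / 2) (hH : 3 * (ℓ * (ℓ - 1) / 2) ≤ H.ncard)
    (h : IsAnchoredKCore (CliqueGadget n ℓ G) 3 B H) :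
    ∃ s : Finset (Fin n), G.IsNClique ℓ s := by
  have heven : ℓ * (ℓ - 1) / 2 * 2 = ℓ * (ℓ - 1) :=
    Nat.div_mul_cancel (Nat.even_mul_pred_self ℓ).two_dvd
  have hpos : 0 < ℓ * (ℓ - 1) := Nat.mul_pos (by omega) (by omega)
  set N := ℓ * (ℓ - 1) / 2
  let Γ : Set {q : (Fin n × Fin n) × Fin ℓ × Fin ℓ // G.Adj q.1.1 q.1.2 ∧ q.2.1 < q.2.2} :=
    {g | (Sum.inr g : GadgetVert n ℓ G) ∈ H}
  let f : {q : (Fin n × Fin n) × Fin ℓ × Fin ℓ // G.Adj q.1.1 q.1.2 ∧ q.2.1 < q.2.2} × Bool →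
    GadgetVert n ℓ G := fun x => Sum.inl (greenEnd x.1 x.2)
  have hΓB : Sum.inr '' Γ ⊆ B := by
    rintro _ ⟨g, hg, rfl⟩
    exact inr_mem_of_isAnchoredKCore h hg
  have hΓ : Γ.ncard ≤ B.ncard := by
    rw [← Set.ncard_image_of_injective Γ Sum.inr_injective]
    exact Set.ncard_le_ncard hΓB (Set.toFinite _)
  have hsub : H \ B ⊆ f '' (Γ ×ˢ Set.univ) := by
    rintro (a | g) ha
    · obtain ⟨g, b, hg, rfl⟩ := exists_green_of_isAnchoredKCore hℓ h ha
      exact ⟨(g, b), ⟨hg, trivial⟩, rfl⟩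
    · exact absurd (inr_mem_of_isAnchoredKCore h ha.1) ha.2
  have hprod : (Γ ×ˢ (Set.univ : Set Bool)).ncard = Γ.ncard * 2 := by
    rw [Set.ncard_prod, Set.ncard_univ]; simp
  have himg : (f '' (Γ ×ˢ Set.univ)).ncard ≤ (Γ ×ˢ (Set.univ : Set Bool)).ncard :=
    Set.ncard_image_le (Set.toFinite _)
  have hdiff : (H \ B).ncard + B.ncard = H.ncard :=
    Set.ncard_sdiff_add_ncard_of_subset h.1 (Set.toFinite _)
  have hle := Set.ncard_le_ncard hsub (Set.toFinite _)
  have hcard : (H \ B).ncard = ℓ * (ℓ - 1) := by omega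
  have hHB : H \ B = f '' (Γ ×ˢ Set.univ) :=
    Set.eq_of_subset_of_ncard_le hsub (by omega) (Set.toFinite _)
  have hBΓ : Sum.inr '' Γ = B :=
    Set.eq_of_subset_of_ncard_le hΓB
      (by rw [Set.ncard_image_of_injective Γ Sum.inr_injective]; omega) (Set.toFinite _)
  have hinj : Set.InjOn f (Γ ×ˢ Set.univ) :=
    Set.injOn_of_ncard_image_eq (by omega) (Set.toFinite _)
  have hinl : ∀ a, (Sum.inl a : GadgetVert n ℓ G) ∈ H → Sum.inl a ∈ H \ B := by
    refine fun a ha => ⟨ha, fun haB => ?_⟩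
    rw [← hBΓ] at haB
    simp at haB
  have hnext : ∀ a, (Sum.inl a : GadgetVert n ℓ G) ∈ H →
      Sum.inl (gadgetNext (by omega) a) ∈ H := by
    refine fun a ha => gadgetNext_mem_of_isAnchoredKCore hℓ h (hinl a ha) ?_
    intro g g' b b' hg hg' hb hb'
    have := @hinj (g, b) ⟨hg, trivial⟩ (g', b') ⟨hg', trivial⟩ (by simp [f, hb, hb'])
    exact congrArg Prod.fst this
  have hcyc : ∀ r i j k (hij : i ≠ j) (hik : i ≠ k),
      (Sum.inl ⟨(r, i, j), hij⟩ : GadgetVert n ℓ G) ∈ H →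
      (Sum.inl ⟨(r, i, k), hik⟩ : GadgetVert n ℓ G) ∈ H := by
    intro r i j k hij hik hmem
    obtain ⟨_, h'⟩ := mem_of_cycNext_closed (by omega) hij.symm
      (S := {k | ∃ hik : i ≠ k, (Sum.inl ⟨(r, i, k), hik⟩ : GadgetVert n ℓ G) ∈ H})
      ⟨hij, hmem⟩ (fun k _ ⟨hik, hk⟩ => ⟨(cycNext_ne (by omega)).symm, hnext _ hk⟩) hik.symm
    exact h'
  have hpartner : ∀ r i j (hij : i ≠ j), (Sum.inl ⟨(r, i, j), hij⟩ : GadgetVert n ℓ G) ∈ H →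
      ∃ s, G.Adj r s ∧ (Sum.inl ⟨(s, j, i), hij.symm⟩ : GadgetVert n ℓ G) ∈ H := by
    intro r i j hij hmem
    obtain ⟨g, b, hg, hgb⟩ := exists_green_of_isAnchoredKCore hℓ h (hinl _ hmem)
    have hother : Sum.inl (greenEnd g !b) ∈ H \ B := by
      rw [hHB]; exact ⟨(g, !b), ⟨hg, trivial⟩, rfl⟩
    obtain ⟨⟨⟨r', s'⟩, i', j'⟩, hadj, hlt⟩ := g
    cases b <;> simp only [greenEnd, Subtype.mk.injEq, Prod.mk.injEq] at hgb <;>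
      obtain ⟨rfl, rfl, rfl⟩ := hgb
    · exact ⟨r', hadj.symm, hother.1⟩
    · exact ⟨s', hadj, hother.1⟩
  have hrow : ∀ i, ∃ r, ∀ j (hij : i ≠ j),
      (Sum.inl ⟨(r, i, j), hij⟩ : GadgetVert n ℓ G) ∈ H := by
    obtain ⟨x, hx⟩ : (H \ B).Nonempty := by
      rw [← Set.ncard_pos (Set.toFinite _)]; omega
    rw [hHB] at hx
    obtain ⟨y, hy, rfl⟩ := hx
    have hmem : f y ∈ H \ B := by rw [hHB]; exact ⟨y, hy, rfl⟩
    obtain ⟨⟨⟨r, i₀, j₀⟩, hij₀⟩, ha⟩ : ∃ a, f y = Sum.inl a := ⟨_, rfl⟩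
    rw [ha] at hmem
    intro i
    by_cases hi : i₀ = i
    · subst hi
      exact ⟨r, fun j hij => hcyc _ _ _ _ _ _ hmem.1⟩
    · obtain ⟨s, -, hs⟩ := hpartner r i₀ i hi (hcyc _ _ _ _ _ _ hmem.1)
      exact ⟨s, fun j hij => hcyc _ _ _ _ _ _ hs⟩
  choose c hc using hrow
  let φ : {p : Fin ℓ × Fin ℓ // p.1 ≠ p.2} → GadgetVert n ℓ G :=
    fun p => Sum.inl ⟨(c p.1.1, p.1.1, p.1.2), p.2⟩
  have hφ : Function.Injective φ := by
    rintro ⟨⟨i, j⟩, _⟩ ⟨⟨i', j'⟩, _⟩ hp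
    simp only [φ, Sum.inl.injEq, Subtype.mk.injEq, Prod.mk.injEq] at hp
    simp [hp.2]
  have hφH : Set.range φ = H \ B := by
    refine Set.eq_of_subset_of_ncard_le ?_ ?_ (Set.toFinite _)
    · rintro _ ⟨p, rfl⟩
      exact hinl _ (hc _ _ _)
    · rw [← Set.image_univ, Set.ncard_image_of_injective _ hφ, Set.ncard_univ, hcard,
        card_ne_pairs]
  have hadj : ∀ i j, i ≠ j → G.Adj (c i) (c j) := by
    intro i j hij
    obtain ⟨s, hs, hsH⟩ := hpartner _ _ _ hij (hc i j hij)
    have hsH' := hinl _ hsH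
    rw [← hφH] at hsH'
    obtain ⟨⟨⟨i', j'⟩, _⟩, hp⟩ := hsH'
    simp only [φ, Sum.inl.injEq, Subtype.mk.injEq, Prod.mk.injEq] at hp
    obtain ⟨rfl, rfl, rfl⟩ := hp
    exact hs
  have hcinj : Function.Injective c := fun i j hij => by
    by_contra hne
    exact (hadj i j hne).ne hij
  refine ⟨Finset.univ.image c, ?_, by rw [Finset.card_image_of_injective _ hcinj]; simp⟩
  rintro x hx y hy hxy
  simp only [Finset.coe_image, Finset.coe_univ, Set.image_univ, Set.mem_range] at hx hy
  obtain ⟨i, rfl⟩ := hx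
  obtain ⟨j, rfl⟩ := hy
  exact hadj i j fun hij => hxy (congrArg c hij)

theorem exists_isAnchoredKCore_of_isNClique (hℓ : 4 ≤ ℓ) {s : Finset (Fin n)}
    (hs : G.IsNClique ℓ s) :
    ∃ B H : Set (GadgetVert n ℓ G), B ⊆ H ∧ B.ncard ≤ ℓ * (ℓ - 1) / 2 ∧
      3 * (ℓ * (ℓ - 1) / 2) ≤ H.ncard ∧ IsAnchoredKCore (CliqueGadget n ℓ G) 3 B H := by
  have heven : ℓ * (ℓ - 1) / 2 * 2 = ℓ * (ℓ - 1) :=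
    Nat.div_mul_cancel (Nat.even_mul_pred_self ℓ).two_dvd
  let e := (s.equivFinOfCardEq hs.card_eq).symm
  let c : Fin ℓ → Fin n := fun i => e i
  have hadj : ∀ i j, i ≠ j → G.Adj (c i) (c j) := fun i j hij =>
    hs.isClique (e i).2 (e j).2 fun h => hij (e.injective (Subtype.ext h))
  let φ : {p : Fin ℓ × Fin ℓ // p.1 ≠ p.2} → GadgetVert n ℓ G :=
    fun p => Sum.inl ⟨(c p.1.1, p.1.1, p.1.2), p.2⟩
  let ψ : {p : Fin ℓ × Fin ℓ // p.1 < p.2} → GadgetVert n ℓ G :=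
    fun p => Sum.inr ⟨((c p.1.1, c p.1.2), p.1.1, p.1.2), hadj _ _ p.2.ne, p.2⟩
  have hφ : Function.Injective φ := by
    rintro ⟨⟨i, j⟩, _⟩ ⟨⟨i', j'⟩, _⟩ hp
    simp only [φ, Sum.inl.injEq, Subtype.mk.injEq, Prod.mk.injEq] at hp
    simp [hp.2]
  have hψ : Function.Injective ψ := by
    rintro ⟨⟨i, j⟩, _⟩ ⟨⟨i', j'⟩, _⟩ hp
    simp only [ψ, Sum.inr.injEq, Subtype.mk.injEq, Prod.mk.injEq] at hp
    simp [hp.2]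
  have hφc : (Set.range φ).ncard = ℓ * (ℓ - 1) := by
    rw [← Set.image_univ, Set.ncard_image_of_injective _ hφ, Set.ncard_univ, card_ne_pairs]
  have hψc : (Set.range ψ).ncard = ℓ * (ℓ - 1) / 2 := by
    rw [← Set.image_univ, Set.ncard_image_of_injective _ hψ, Set.ncard_univ, card_lt_pairs]
  refine ⟨Set.range ψ, Set.range φ ∪ Set.range ψ, Set.subset_union_right, hψc.le, ?_,
    Set.subset_union_right, ?_⟩
  · rw [Set.ncard_union_eq _ (Set.toFinite _) (Set.toFinite _), hφc, hψc]
    · omega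
    · rw [Set.disjoint_left]
      rintro _ ⟨p, rfl⟩ ⟨q, hq⟩
      simp [φ, ψ] at hq
  · rintro _ ⟨⟨p, rfl⟩ | hv, hvB⟩
    swap
    · exact absurd hv hvB
    obtain ⟨⟨i, j⟩, hij⟩ := p
    obtain ⟨p, hpne, hp1, hp2, hp⟩ := exists_cliqueGadget_adj_inl_iff (G := G) hℓ
      ⟨(c i, i, j), hij⟩
    obtain ⟨q, hq⟩ : ∃ q, (CliqueGadget n ℓ G).Adj (φ ⟨(i, j), hij⟩) (ψ q) := by
      rcases lt_or_gt_of_ne hij with hlt | hlt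
      · exact ⟨⟨(i, j), hlt⟩, cliqueGadget_adj_inl_inr.2 ⟨true, rfl⟩⟩
      · exact ⟨⟨(j, i), hlt⟩, cliqueGadget_adj_inl_inr.2 ⟨false, rfl⟩⟩
    have hsub : ({Sum.inl p, Sum.inl (gadgetNext (by omega) ⟨(c i, i, j), hij⟩), ψ q} :
        Set (GadgetVert n ℓ G)) ⊆
        {u | u ∈ Set.range φ ∪ Set.range ψ ∧ (CliqueGadget n ℓ G).Adj (φ ⟨(i, j), hij⟩) u} := by
      rintro _ (rfl | rfl | rfl)
      · refine ⟨Or.inl ⟨⟨p.1.2, p.2⟩, ?_⟩, (hp _).2 (Or.inr rfl)⟩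
        simp only [φ, Sum.inl.injEq]
        apply Subtype.ext
        obtain ⟨⟨r, i', k⟩, hk⟩ := p
        simp only at hp1 hp2
        subst hp1 hp2
        rfl
      · exact ⟨Or.inl ⟨⟨(i, cycNext i j), (cycNext_ne (by omega)).symm⟩, rfl⟩,
          (hp _).2 (Or.inl rfl)⟩
      · exact ⟨Or.inr ⟨q, rfl⟩, hq⟩
    refine le_trans (le_of_eq ?_) (Set.ncard_le_ncard hsub (Set.toFinite _))
    exact (Set.ncard_eq_three.2 ⟨_, _, _, by simpa using hpne, by simp [ψ], by simp [ψ], rfl⟩).symm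

end Gadget

theorem stmt_6 (n ℓ : ℕ) (hℓ : 4 ≤ ℓ) (G : SimpleGraph (Fin n)) :
    (∃ s : Finset (Fin n), G.IsNClique ℓ s) ↔
    ∃ B H : Set (GadgetVert n ℓ G), B ⊆ H ∧ B.ncard ≤ ℓ * (ℓ - 1) / 2 ∧
      3 * (ℓ * (ℓ - 1) / 2) ≤ H.ncard ∧ IsAnchoredKCore (CliqueGadget n ℓ G) 3 B H := by
  constructor
  · rintro ⟨s, hs⟩
    exact exists_isAnchoredKCore_of_isNClique hℓ hs
  · rintro ⟨B, H, -, hB, hH, h⟩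
    exact exists_isNClique_of_isAnchoredKCore hℓ hB hH h
end

section
/- Fix an integer k ≥ 4. Let φ be a CNF formula with variables x_1,…,x_n and clauses C_1,…,C_m such that each clause has at most 3 literals, each variable occurs in at most 3 clauses, and each variable occurs at least once positively and at least once negatively, and let G = SatGadget(φ,k). If φ has a satisfying assignment f, then taking B' = {x_i : f(x_i)=1} ∪ {x̄_i : f(x_i)=0}, B'' = {x_i, x̄_i : i ∈ {1,…,n}} \ B', B = B' ∪ (Z_1 ∪ … ∪ Z_n) ∪ (W_1 ∪ … ∪ W_m) and H = V(G) \ B'', the pair (B,H) is an anchored k-core of G with |B| = n((k−1)²+1) + m(k−1)² and |H| = |B| + nk + mk. -/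
/-- Vertices of `SatGadget(φ, k)` for a CNF formula `φ` with `n` variables and `m` clauses:
`R i` is `r_i`; `X i true` is the literal vertex `x_i` and `X i false` is `x̄_i`;
`Cl j` is the clause vertex `v_j`; `Y i s` is the `s`-th vertex of `Y_i` and `Z i s t`
its `t`-th pendant neighbor (so `Z_i = {Z i s t}`); `U j s` is the `s`-th vertex of `U_j`
and `W j s t` its `t`-th pendant neighbor (so `W_j = {W j s t}`). -/
inductive SatVert (n m k : ℕ) where
  | R (i : Fin n)
  | X (i : Fin n) (b : Bool)
  | Cl (j : Fin m)
  | Y (i : Fin n) (s : Fin (k - 1))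
  | Z (i : Fin n) (s : Fin (k - 1)) (t : Fin (k - 1))
  | U (j : Fin m) (s : Fin (k - 1))
  | W (j : Fin m) (s : Fin (k - 1)) (t : Fin (k - 1))
  deriving DecidableEq

/-- The graph `SatGadget(φ, k)`, where the clause `C_j` of `φ` is the finite set `C j` of
literals, a literal being a pair `(i, b)` meaning `x_i` if `b = true` and `¬x_i` if
`b = false`. Edges: `r_i x_i`, `r_i x̄_i`; a literal vertex is joined to `v_j` iff the
literal occurs in `C_j`; `r_i` is joined to the `k−1` vertices of `Y_i`, each of which gets
`k−1` pendant neighbors (the set `Z_i`); `v_j` is joined to the `k−1` vertices of `U_j`,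
each of which gets `k−1` pendant neighbors (the set `W_j`). -/
def SatGadget (n m k : ℕ) (C : Fin m → Finset (Fin n × Bool)) :
    SimpleGraph (SatVert n m k) :=
  SimpleGraph.fromRel (fun a b =>
    match a, b with
    | .R i, .X i' _ => i = i'
    | .X i bl, .Cl j => (i, bl) ∈ C j
    | .R i, .Y i' _ => i = i'
    | .Y i s, .Z i' s' _ => i = i' ∧ s = s'
    | .Cl j, .U j' _ => j = j'
    | .U j s, .W j' s' _ => j = j' ∧ s = s'
    | _, _ => False)

/-- A set containing an injective image of `Option (Fin (k - 1))` has at least `k` elements. -/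
theorem le_ncard_of_injective_option {α : Type*} {k : ℕ} (hk : 1 ≤ k) {s : Set α} (hs : s.Finite)
    (g : Option (Fin (k - 1)) → α) (hg : Function.Injective g) (hgs : ∀ o, g o ∈ s) :
    k ≤ s.ncard := by
  have h := Set.ncard_le_ncard (Set.range_subset_iff.2 hgs) hs
  rw [Set.ncard_range_of_injective hg] at h
  simpa [Nat.sub_add_cancel hk] using h

namespace SatVert

variable {n m k : ℕ}

/-- Enumeration of the anchors: the true literals and the pendant vertices. -/
def anchorMap (f : Fin n → Bool) :
    Fin n ⊕ (Fin n × Fin (k - 1) × Fin (k - 1)) ⊕ (Fin m × Fin (k - 1) × Fin (k - 1)) →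
      SatVert n m k
  | .inl i => .X i (f i)
  | .inr (.inl (i, s, t)) => .Z i s t
  | .inr (.inr (j, s, t)) => .W j s t

/-- Enumeration of the vertices that are neither anchors nor false literals. -/
def innerMap :
    (Fin n ⊕ Fin m) ⊕ (Fin n × Fin (k - 1)) ⊕ (Fin m × Fin (k - 1)) → SatVert n m k
  | .inl (.inl i) => .R i
  | .inl (.inr j) => .Cl j
  | .inr (.inl (i, s)) => .Y i s
  | .inr (.inr (j, s)) => .U j s

theorem sumElim_anchorMap_innerMap_injective (f : Fin n → Bool) :
    Function.Injective (Sum.elim (anchorMap (m := m) (k := k) f) innerMap) := by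
  rintro ((_ | (_ | _)) | ((_ | _) | (_ | _))) ((_ | (_ | _)) | ((_ | _) | (_ | _))) h <;>
    simp_all [anchorMap, innerMap, Prod.ext_iff]

theorem range_anchorMap (f : Fin n → Bool) :
    Set.range (anchorMap (m := m) (k := k) f) =
      {x : SatVert n m k | ∃ i, x = .X i (f i)} ∪
       {x : SatVert n m k | ∃ i s t, x = .Z i s t} ∪
       {x : SatVert n m k | ∃ j s t, x = .W j s t} := by
  ext x
  cases x <;> simp [anchorMap, eq_comm]

theorem range_sumElim (f : Fin n → Bool) :
    Set.range (Sum.elim (anchorMap (m := m) (k := k) f) innerMap) =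
      Set.univ \ {x : SatVert n m k | ∃ i, x = .X i (!f i)} := by
  ext x
  cases x <;> simp [anchorMap, innerMap]
  exact eq_comm

end SatVert

theorem stmt_10 (n m k : ℕ) (hk : 4 ≤ k) (C : Fin m → Finset (Fin n × Bool))
    (hclause : ∀ j, (C j).card ≤ 3)
    (hvar : ∀ i : Fin n,
      (Finset.univ.filter fun j : Fin m => (i, true) ∈ C j ∨ (i, false) ∈ C j).card ≤ 3)
    (hpos : ∀ i : Fin n, ∃ j, (i, true) ∈ C j)
    (hneg : ∀ i : Fin n, ∃ j, (i, false) ∈ C j)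
    (f : Fin n → Bool) (hf : ∀ j, ∃ i, (i, f i) ∈ C j) :
    IsAnchoredKCore (SatGadget n m k C) k
      ({x : SatVert n m k | ∃ i, x = .X i (f i)} ∪
       {x : SatVert n m k | ∃ i s t, x = .Z i s t} ∪
       {x : SatVert n m k | ∃ j s t, x = .W j s t})
      (Set.univ \ {x : SatVert n m k | ∃ i, x = .X i (!f i)}) ∧
    ({x : SatVert n m k | ∃ i, x = .X i (f i)} ∪
     {x : SatVert n m k | ∃ i s t, x = .Z i s t} ∪
     {x : SatVert n m k | ∃ j s t, x = .W j s t}).ncard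
      = n * ((k - 1) ^ 2 + 1) + m * (k - 1) ^ 2 ∧
    (Set.univ \ {x : SatVert n m k | ∃ i, x = .X i (!f i)}).ncard
      = ({x : SatVert n m k | ∃ i, x = .X i (f i)} ∪
         {x : SatVert n m k | ∃ i s t, x = .Z i s t} ∪
         {x : SatVert n m k | ∃ j s t, x = .W j s t}).ncard + n * k + m * k := by
  have hB := SatVert.range_anchorMap (m := m) (k := k) f
  have hH := SatVert.range_sumElim (m := m) (k := k) f
  have hinj := SatVert.sumElim_anchorMap_innerMap_injective (m := m) (k := k) f
  have hinj_anchor : Function.Injective (SatVert.anchorMap (m := m) (k := k) f) :=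
    hinj.comp Sum.inl_injective
  obtain ⟨d, rfl⟩ : ∃ d, k = d + 1 := ⟨k - 1, by omega⟩
  refine ⟨⟨?_, ?_⟩, ?_, ?_⟩
  · rw [← hB, ← hH, Set.Sum.elim_range]
    exact Set.subset_union_left
  · have hfin : (Set.univ \ {x : SatVert n m (d + 1) | ∃ i, x = .X i (!f i)}).Finite :=
      hH ▸ Set.finite_range _
    rintro v ⟨hvH, hvB⟩
    have hdeg := fun a g => le_ncard_of_injective_option (k := d + 1) (by omega)
      (hfin.subset fun u (hu : u ∈ {u | u ∈ _ ∧ (SatGadget n m (d + 1) C).Adj v u}) => hu.1)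
      (fun o => Option.elim o a g)
    have option_injective : ∀ (a : SatVert n m (d + 1)) (g : Fin (d + 1 - 1) → _),
        Function.Injective g → (∀ s, g s ≠ a) →
        Function.Injective fun o => Option.elim o a g := by
      rintro a g hg ha (_ | s) (_ | t) h
      · rfl
      · exact absurd h.symm (ha t)
      · exact absurd h (ha s)
      · exact congrArg some (hg h)
    cases v with
    | R i =>
      refine hdeg (.X i (f i)) (.Y i) (option_injective _ _ (fun s t h => by simpa using h)
        (by simp)) ?_
      rintro (_ | s) <;> simp [SatGadget]
    | X i b =>
      cases b <;> cases h : f i <;> simp_all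
    | Cl j =>
      obtain ⟨i, hi⟩ := hf j
      refine hdeg (.X i (f i)) (.U j) (option_injective _ _ (fun s t h => by simpa using h)
        (by simp)) ?_
      rintro (_ | s) <;> simp [SatGadget, hi]
    | Y i s =>
      refine hdeg (.R i) (.Z i s) (option_injective _ _ (fun s t h => by simpa using h)
        (by simp)) ?_
      rintro (_ | t) <;> simp [SatGadget]
    | U j s =>
      refine hdeg (.Cl j) (.W j s) (option_injective _ _ (fun s t h => by simpa using h)
        (by simp)) ?_
      rintro (_ | t) <;> simp [SatGadget]
    | Z i s t => simp at hvB
    | W j s t => simp at hvB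
  · rw [← hB, Set.ncard_range_of_injective hinj_anchor]
    simp
    ring
  · rw [← hB, ← hH, Set.ncard_range_of_injective hinj,
      Set.ncard_range_of_injective hinj_anchor]
    simp
    ring
end

section
/- Let k ≥ 7 be an integer, let G be a finite simple graph, and let B ⊆ H ⊆ V(G) with H nonempty be such that (B,H) is an anchored k-core of G and the induced subgraph G[H] has at most 3|H| − 6 edges (as holds whenever G is planar). Then |H| < 7|B|. -/
open scoped Classical in
/-- The degree of `v` in the induced subgraph `G[H]` counts its neighbors in `H`. -/
theorem SimpleGraph.degree_induce_eq_ncard {V : Type*} [Fintype V] (G : SimpleGraph V)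
    (H : Set V) (v : H) :
    (G.induce H).degree v = {u | u ∈ H ∧ G.Adj v u}.ncard := by
  have himage : {u | u ∈ H ∧ G.Adj v u} = Subtype.val '' ((G.induce H).neighborSet v) := by
    ext u
    simp [and_comm]
  rw [himage, Set.ncard_image_of_injective _ Subtype.val_injective, Set.ncard_eq_toFinset_card',
    Set.toFinset_card, SimpleGraph.card_neighborSet_eq_degree]

open scoped Classical in
/-- In an anchored `k`-core, the non-anchors contribute at least `k` each to twice the number of
edges. -/
theorem IsAnchoredKCore.mul_ncard_le {V : Type*} [Fintype V] {G : SimpleGraph V} {k : ℕ}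
    {B H : Set V} (hcore : IsAnchoredKCore G k B H) :
    k * H.ncard ≤ 2 * (G.induce H).edgeSet.ncard + k * B.ncard := by
  have hedges : (G.induce H).edgeSet.ncard = (G.induce H).edgeFinset.card := by
    rw [Set.ncard_eq_toFinset_card', SimpleGraph.edgeFinset]
  have hanchors : (Finset.univ.filter fun v : H => (v : V) ∈ B).card ≤ B.ncard := by
    rw [Set.ncard_eq_toFinset_card']
    exact Finset.card_le_card_of_injOn Subtype.val (by intro v; simp)
      Subtype.val_injective.injOn
  calc k * H.ncard = ∑ _v : H, k := by
        simp [Set.ncard_eq_toFinset_card', mul_comm]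
    _ ≤ ∑ v : H, ((G.induce H).degree v + if (v : V) ∈ B then k else 0) := by
        refine Finset.sum_le_sum fun v _ => ?_
        split_ifs with hv
        · exact Nat.le_add_left _ _
        · rw [G.degree_induce_eq_ncard H v]
          exact hcore.2 v ⟨v.2, hv⟩
    _ = 2 * (G.induce H).edgeSet.ncard +
          k * (Finset.univ.filter fun v : H => (v : V) ∈ B).card := by
        rw [Finset.sum_add_distrib, SimpleGraph.sum_degrees_eq_twice_card_edges, hedges,
          ← Finset.sum_filter, Finset.sum_const, smul_eq_mul, mul_comm k]
    _ ≤ _ := by gcongr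

theorem stmt_13 {V : Type} [Fintype V] (G : SimpleGraph V) (k : ℕ) (hk : 7 ≤ k)
    (B H : Set V) (hne : H.Nonempty) (hcore : IsAnchoredKCore G k B H)
    (hE : ((G.induce H).edgeSet.ncard : ℤ) ≤ 3 * (H.ncard : ℤ) - 6) :
    H.ncard < 7 * B.ncard := by
  have hcore7 : IsAnchoredKCore G 7 B H := ⟨hcore.1, fun v hv => hk.trans (hcore.2 v hv)⟩
  have := hcore7.mul_ncard_le
  omega
end
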